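/- Let m, n ≥ 3 be integers. Then the Seidel energy strictly decreases under Type-II hyperedge deletion: the sum of the absolute values of the eigenvalues of S(m,n) is strictly greater than the sum of the absolute values of the eigenvalues of S_II(m,n); that is, E_S(C^3_{m,n}) > E_S(C^3_{m,n} - e) for a hyperedge e containing two vertices of the first block and one vertex of the second block. -/

import Mathlib

open Polynomial Matrix

/-- The Seidel matrix of the complete 3-uniform bipartite hypergraph `C³_{m,n}`. -/
noncomputable def seidelS (m n : ℕ) : Matrix (Fin m ⊕ Fin n) (Fin m ⊕ Fin n) ℝ :=
  fun i j =>
    if i = j then 0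
    else
      match i, j with
      | Sum.inl _, Sum.inl _ => 1 - 2 * (n : ℝ)
      | Sum.inr _, Sum.inr _ => 1 - 2 * (m : ℝ)
      | _, _ => 1 - 2 * ((m : ℝ) + (n : ℝ) - 2)

/-- Type-I hyperedge-deleted Seidel matrix. -/
noncomputable def seidelI (m n : ℕ) : Matrix (Fin m ⊕ Fin n) (Fin m ⊕ Fin n) ℝ :=
  fun i j =>
    match i, j with
    | Sum.inl a, Sum.inr b =>
        if a.val = 0 ∧ b.val ≤ 1 then 1 - 2 * ((m : ℝ) + (n : ℝ) - 3)
        else seidelS m n (Sum.inl a) (Sum.inr b)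
    | Sum.inr b, Sum.inl a =>
        if a.val = 0 ∧ b.val ≤ 1 then 1 - 2 * ((m : ℝ) + (n : ℝ) - 3)
        else seidelS m n (Sum.inr b) (Sum.inl a)
    | Sum.inr a, Sum.inr b =>
        if (a.val = 0 ∧ b.val = 1) ∨ (a.val = 1 ∧ b.val = 0) then 1 - 2 * ((m : ℝ) - 1)
        else seidelS m n (Sum.inr a) (Sum.inr b)
    | Sum.inl a, Sum.inl b => seidelS m n (Sum.inl a) (Sum.inl b)

/-- Type-II hyperedge-deleted Seidel matrix. -/
noncomputable def seidelII (m n : ℕ) : Matrix (Fin m ⊕ Fin n) (Fin m ⊕ Fin n) ℝ :=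
  fun i j =>
    match i, j with
    | Sum.inl a, Sum.inl b =>
        if (a.val = 0 ∧ b.val = 1) ∨ (a.val = 1 ∧ b.val = 0) then 1 - 2 * ((n : ℝ) - 1)
        else seidelS m n (Sum.inl a) (Sum.inl b)
    | Sum.inl a, Sum.inr b =>
        if a.val ≤ 1 ∧ b.val = 0 then 1 - 2 * ((m : ℝ) + (n : ℝ) - 3)
        else seidelS m n (Sum.inl a) (Sum.inr b)
    | Sum.inr b, Sum.inl a =>
        if a.val ≤ 1 ∧ b.val = 0 then 1 - 2 * ((m : ℝ) + (n : ℝ) - 3)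
        else seidelS m n (Sum.inr b) (Sum.inl a)
    | Sum.inr a, Sum.inr b => seidelS m n (Sum.inr a) (Sum.inr b)

/-- Seidel energy: sum of absolute values of the eigenvalues (roots of the
characteristic polynomial, with multiplicity). -/
noncomputable def seidelEnergy {k : Type*} [Fintype k] [DecidableEq k]
    (M : Matrix k k ℝ) : ℝ :=
  (M.charpoly.roots.map (fun x => |x|)).sum

section Energy

variable {k : Type*} [Fintype k] [DecidableEq k]

theorem seidelEnergy_eq_sum_abs_eigenvalues {M : Matrix k k ℝ} (hM : M.IsHermitian) :
    seidelEnergy M = ∑ i, |hM.eigenvalues i| := by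
  rw [seidelEnergy, hM.roots_charpoly_eq_eigenvalues]
  simp only [Multiset.map_map, Function.comp_apply]
  rfl

theorem eigenvalues_sum_eq_zero {M : Matrix k k ℝ} (hM : M.IsHermitian) (ht : M.trace = 0) :
    ∑ i, hM.eigenvalues i = 0 := by
  have h := hM.trace_eq_sum_eigenvalues
  rw [ht] at h
  simpa using h.symm

theorem neg_seidelEnergy_half_le_eigenvalues {M : Matrix k k ℝ} (hM : M.IsHermitian)
    (ht : M.trace = 0) (i : k) : -(seidelEnergy M / 2) ≤ hM.eigenvalues i := by
  have h0 := eigenvalues_sum_eq_zero hM ht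
  have h1 : |hM.eigenvalues i| - hM.eigenvalues i ≤
      ∑ j, (|hM.eigenvalues j| - hM.eigenvalues j) :=
    Finset.single_le_sum (f := fun j => |hM.eigenvalues j| - hM.eigenvalues j)
      (fun j _ => sub_nonneg.2 (le_abs_self _)) (Finset.mem_univ i)
  rw [Finset.sum_sub_distrib, h0, ← seidelEnergy_eq_sum_abs_eigenvalues hM] at h1
  have := neg_abs_le (hM.eigenvalues i)
  linarith

theorem posSemidef_add_seidelEnergy_half {M : Matrix k k ℝ} (hM : M.IsHermitian)
    (ht : M.trace = 0) : (M + (seidelEnergy M / 2) • (1 : Matrix k k ℝ)).PosSemidef := by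
  set c := seidelEnergy M / 2 with hc
  have hA : (M + c • (1 : Matrix k k ℝ)).IsHermitian :=
    hM.add (by simp [IsHermitian])
  rw [hA.posSemidef_iff_eigenvalues_nonneg]
  intro i
  have hv := hA.mulVec_eigenvectorBasis i
  have hne : (hA.eigenvectorBasis i).ofLp ≠ 0 := by
    intro h
    exact hA.eigenvectorBasis.orthonormal.ne_zero i (by ext j; simpa using congrFun h j)
  have hdet : M.charpoly.IsRoot (hA.eigenvalues i - c) := by
    rw [IsRoot.def, eval_charpoly, ← exists_mulVec_eq_zero_iff]
    refine ⟨_, hne, ?_⟩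
    rw [add_mulVec, smul_mulVec, one_mulVec] at hv
    rw [sub_mulVec, scalar_apply, ← smul_one_eq_diagonal, smul_mulVec, one_mulVec, sub_smul, ← hv]
    abel
  have hmem : hA.eigenvalues i - c ∈ M.charpoly.roots :=
    (mem_roots M.charpoly_monic.ne_zero).2 hdet
  rw [hM.roots_charpoly_eq_eigenvalues] at hmem
  obtain ⟨j, -, hj⟩ := Multiset.mem_map.1 hmem
  have := neg_seidelEnergy_half_le_eigenvalues hM ht j
  simp at hj
  simp
  linarith

theorem eigenvectorBasis_dotProduct {M : Matrix k k ℝ} (hM : M.IsHermitian) (i j : k) :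
    (hM.eigenvectorBasis i).ofLp ⬝ᵥ (hM.eigenvectorBasis j).ofLp = if i = j then 1 else 0 := by
  rw [dotProduct_comm, ← orthonormal_iff_ite.1 hM.eigenvectorBasis.orthonormal i j,
    EuclideanSpace.inner_eq_star_dotProduct]
  simp

/-- A symmetric matrix that is nonnegative on a hyperplane has at most one negative eigenvalue. -/
theorem eq_of_eigenvalues_neg {M : Matrix k k ℝ} (hM : M.IsHermitian) (w : k → ℝ)
    (hw : ∀ x, w ⬝ᵥ x = 0 → 0 ≤ x ⬝ᵥ M *ᵥ x) {i j : k}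
    (hi : hM.eigenvalues i < 0) (hj : hM.eigenvalues j < 0) : i = j := by
  by_contra hij
  have hq (a b : ℝ) (h : a * (w ⬝ᵥ (hM.eigenvectorBasis i).ofLp) +
      b * (w ⬝ᵥ (hM.eigenvectorBasis j).ofLp) = 0) :
      0 ≤ a ^ 2 * hM.eigenvalues i + b ^ 2 * hM.eigenvalues j := by
    have := hw (a • (hM.eigenvectorBasis i).ofLp + b • (hM.eigenvectorBasis j).ofLp)
      (by simpa [dotProduct_add] using h)
    simp only [mulVec_add, mulVec_smul, hM.mulVec_eigenvectorBasis, dotProduct_add,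
      add_dotProduct, dotProduct_smul, smul_dotProduct, eigenvectorBasis_dotProduct,
      if_neg hij, if_neg (Ne.symm hij), smul_eq_mul, if_true] at this
    linarith
  by_cases h : w ⬝ᵥ (hM.eigenvectorBasis i).ofLp = 0
  · have := hq 1 0 (by simp [h])
    linarith
  · have := hq (w ⬝ᵥ (hM.eigenvectorBasis j).ofLp) (-(w ⬝ᵥ (hM.eigenvectorBasis i).ofLp)) (by ring)
    nlinarith [sq_nonneg (w ⬝ᵥ (hM.eigenvectorBasis j).ofLp), sq_pos_of_ne_zero h]

theorem exists_seidelEnergy_eq_neg_two_mul [Nonempty k] {M : Matrix k k ℝ} (hM : M.IsHermitian)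
    (ht : M.trace = 0) (w : k → ℝ) (hw : ∀ x, w ⬝ᵥ x = 0 → 0 ≤ x ⬝ᵥ M *ᵥ x) :
    ∃ v : k → ℝ, v ⬝ᵥ v = 1 ∧ seidelEnergy M = -2 * (v ⬝ᵥ M *ᵥ v) := by
  have h0 := eigenvalues_sum_eq_zero hM ht
  have key : ∃ i, seidelEnergy M = -2 * hM.eigenvalues i := by
    by_cases hneg : ∃ i, hM.eigenvalues i < 0
    · obtain ⟨i, hi⟩ := hneg
      refine ⟨i, ?_⟩
      have h1 : ∑ j, (|hM.eigenvalues j| - hM.eigenvalues j) =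
          |hM.eigenvalues i| - hM.eigenvalues i := by
        refine Finset.sum_eq_single i (fun j _ hj => ?_) (by simp)
        have : 0 ≤ hM.eigenvalues j :=
          not_lt.1 fun h => hj (eq_of_eigenvalues_neg hM w hw h hi)
        rw [abs_of_nonneg this, sub_self]
      rw [Finset.sum_sub_distrib, h0, ← seidelEnergy_eq_sum_abs_eigenvalues hM,
        abs_of_neg hi] at h1
      linarith
    · push Not at hneg
      have hz := (Finset.sum_eq_zero_iff_of_nonneg fun i _ => hneg i).1 h0
      refine ⟨Classical.arbitrary k, ?_⟩
      rw [seidelEnergy_eq_sum_abs_eigenvalues hM,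
        Finset.sum_congr rfl fun i _ => abs_of_nonneg (hneg i), h0, hz _ (Finset.mem_univ _)]
      simp
  obtain ⟨i, hi⟩ := key
  have h1 := eigenvectorBasis_dotProduct hM i i
  rw [if_pos rfl] at h1
  refine ⟨(hM.eigenvectorBasis i).ofLp, h1, ?_⟩
  rw [hM.mulVec_eigenvectorBasis, dotProduct_smul, h1, hi]
  simp

theorem dotProduct_mulVec_eq_sum {k : Type*} [Fintype k] (M : Matrix k k ℝ) (x : k → ℝ) :
    x ⬝ᵥ M *ᵥ x = ∑ i, ∑ j, M i j * (x i * x j) := by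
  simp only [dotProduct, mulVec, Finset.mul_sum]
  exact Finset.sum_congr rfl fun i _ => Finset.sum_congr rfl fun j _ => by ring

/-- Comparison of Seidel energies for an entrywise smaller matrix with negative off-diagonal
entries. -/
theorem seidelEnergy_lt_of_le [Nonempty k] {M N : Matrix k k ℝ}
    (hM : M.IsHermitian) (hN : N.IsHermitian) (hM0 : ∀ i, M i i = 0) (hN0 : ∀ i, N i i = 0)
    (hMneg : ∀ i j, i ≠ j → M i j < 0) (hNneg : ∀ i j, N i j ≤ 0)
    (hle : ∀ i j, M i j ≤ N i j) {p q : k} (hpq : M p q < N p q)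
    (w : k → ℝ) (hw : ∀ x, w ⬝ᵥ x = 0 → 0 ≤ x ⬝ᵥ N *ᵥ x) :
    seidelEnergy N < seidelEnergy M := by
  have hMt : M.trace = 0 := by simp [trace, hM0]
  have hNt : N.trace = 0 := by simp [trace, hN0]
  obtain ⟨v, hv1, hvE⟩ := exists_seidelEnergy_eq_neg_two_mul hN hNt w hw
  by_contra! hcon
  have hpsd := posSemidef_add_seidelEnergy_half hM hMt
  set x : k → ℝ := fun i => |v i| with hx
  have hx0 (i) : 0 ≤ x i := abs_nonneg _
  have hx1 : x ⬝ᵥ x = 1 := by simpa [dotProduct, hx] using hv1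
  have hterm (i j) : M i j * (x i * x j) ≤ N i j * (v i * v j) := by
    have h1 := mul_le_mul_of_nonneg_right (hle i j) (mul_nonneg (hx0 i) (hx0 j))
    have h2 : N i j * (x i * x j) ≤ N i j * (v i * v j) :=
      mul_le_mul_of_nonpos_left (by simpa [hx, abs_mul] using le_abs_self (v i * v j)) (hNneg i j)
    exact h1.trans h2
  have hform : x ⬝ᵥ (M + (seidelEnergy M / 2) • (1 : Matrix k k ℝ)) *ᵥ x =
      x ⬝ᵥ M *ᵥ x + seidelEnergy M / 2 := by
    rw [add_mulVec, smul_mulVec, one_mulVec, dotProduct_add, dotProduct_smul, hx1]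
    simp
  have hnn := hpsd.dotProduct_mulVec_nonneg x
  rw [star_trivial, hform] at hnn
  have hMN : x ⬝ᵥ M *ᵥ x ≤ v ⬝ᵥ N *ᵥ v := by
    rw [dotProduct_mulVec_eq_sum, dotProduct_mulVec_eq_sum]
    exact Finset.sum_le_sum fun i _ => Finset.sum_le_sum fun j _ => hterm i j
  have hker := (hpsd.dotProduct_mulVec_zero_iff x).1 (by rw [star_trivial, hform]; linarith)
  have hpos (i) : 0 < x i := by
    refine (hx0 i).lt_of_ne' fun hi => ?_
    have h := congrFun hker i
    rw [add_mulVec, smul_mulVec, one_mulVec, Pi.add_apply, Pi.smul_apply, hi, smul_zero,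
      add_zero, Pi.zero_apply, mulVec, dotProduct] at h
    have hnp (j) : M i j * x j ≤ 0 := by
      by_cases hij : i = j
      · simp [← hij, hi]
      · exact mul_nonpos_of_nonpos_of_nonneg (hMneg i j hij).le (hx0 j)
    have hz := (Finset.sum_eq_zero_iff_of_nonpos fun j _ => hnp j).1 h
    have hxz : x = 0 := by
      ext j
      by_cases hij : i = j
      · simpa [← hij] using hi
      · exact (mul_eq_zero.1 (hz j (Finset.mem_univ j))).resolve_left (hMneg i j hij).ne
    simp [hxz] at hx1
  have hlt : x ⬝ᵥ M *ᵥ x < v ⬝ᵥ N *ᵥ v := by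
    rw [dotProduct_mulVec_eq_sum, dotProduct_mulVec_eq_sum]
    refine Finset.sum_lt_sum (fun i _ => Finset.sum_le_sum fun j _ => hterm i j)
      ⟨p, Finset.mem_univ p, Finset.sum_lt_sum (fun j _ => hterm p j) ⟨q, Finset.mem_univ q, ?_⟩⟩
    have h1 := mul_lt_mul_of_pos_right hpq (mul_pos (hpos p) (hpos q))
    have h2 : N p q * (x p * x q) ≤ N p q * (v p * v q) :=
      mul_le_mul_of_nonpos_left (by simpa [hx, abs_mul] using le_abs_self (v p * v q)) (hNneg p q)
    exact h1.trans_le h2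
  linarith

end Energy

/-- The indicator vector of the hyperedge removed in a Type-II deletion. -/
def hyperedgeII (m n : ℕ) : Fin m ⊕ Fin n → ℝ :=
  Sum.elim (fun a => if a.val ≤ 1 then 1 else 0) (fun b => if b.val = 0 then 1 else 0)

theorem seidelS_eq (m n : ℕ) : seidelS m n =
    diagonal (Sum.elim (fun _ => 2 * (n : ℝ) - 1) (fun _ => 2 * (m : ℝ) - 1))
      - vecMulVec (Sum.elim (fun _ => 2 * (n : ℝ) - 1) (fun _ => 2 * ((m : ℝ) + n - 2) - 1))
        (Sum.elim (fun _ => 1) (fun _ => 0))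
      - vecMulVec (Sum.elim (fun _ => 2 * ((m : ℝ) + n - 2) - 1) (fun _ => 2 * (m : ℝ) - 1))
        (Sum.elim (fun _ => 0) (fun _ => 1)) := by
  ext i j
  rcases i with i | i <;> rcases j with j | j <;>
    simp [seidelS, vecMulVec_apply, diagonal_apply] <;> split_ifs <;> ring

theorem seidelII_eq (m n : ℕ) : seidelII m n =
    seidelS m n + (2 : ℝ) • (vecMulVec (hyperedgeII m n) (hyperedgeII m n)
      - diagonal (hyperedgeII m n)) := by
  ext i j
  rcases i with i | i <;> rcases j with j | j <;>
    simp [seidelII, seidelS, hyperedgeII, vecMulVec_apply, diagonal_apply, Fin.ext_iff] <;>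
    split_ifs <;> first | (exfalso; omega) | ring

theorem isHermitian_seidelS (m n : ℕ) : (seidelS m n).IsHermitian := by
  ext i j
  rcases i with i | i <;> rcases j with j | j <;> simp [seidelS, eq_comm]

theorem isHermitian_seidelII (m n : ℕ) : (seidelII m n).IsHermitian := by
  rw [seidelII_eq]
  refine (isHermitian_seidelS m n).add ?_
  ext i j
  simp [vecMulVec_apply, diagonal_apply, mul_comm, eq_comm]
  grind

theorem seidelII_form_nonneg {m n : ℕ} (hm : 3 ≤ m) (hn : 3 ≤ n) (x : Fin m ⊕ Fin n → ℝ)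
    (hx : Sum.elim (fun _ => 2 * (n : ℝ) - 1) (fun _ => 2 * ((m : ℝ) + n - 2) - 1) ⬝ᵥ x = 0) :
    0 ≤ x ⬝ᵥ seidelII m n *ᵥ x := by
  have hm' : (3 : ℝ) ≤ m := by exact_mod_cast hm
  have hn' : (3 : ℝ) ≤ n := by exact_mod_cast hn
  have hdiag : ∑ i, x i * (hyperedgeII m n i * x i) ≤
      ∑ a, x (Sum.inl a) ^ 2 + ∑ b, x (Sum.inr b) ^ 2 := by
    rw [← Fintype.sum_sum_type (fun i => x i ^ 2)]
    refine Finset.sum_le_sum fun i _ => ?_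
    have : hyperedgeII m n i ≤ 1 := by
      rcases i with i | i <;> simp only [hyperedgeII, Sum.elim_inl, Sum.elim_inr] <;>
        split_ifs <;> norm_num
    nlinarith [sq_nonneg (x i)]
  have hX := Finset.sum_nonneg fun (a : Fin m) (_ : a ∈ Finset.univ) => sq_nonneg (x (Sum.inl a))
  have hY := Finset.sum_nonneg fun (b : Fin n) (_ : b ∈ Finset.univ) => sq_nonneg (x (Sum.inr b))
  have hform : x ⬝ᵥ seidelII m n *ᵥ x =
      (2 * n - 1) * ∑ a, x (Sum.inl a) ^ 2 + (2 * m - 1) * ∑ b, x (Sum.inr b) ^ 2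
      - ((2 * n - 1) * (∑ a, x (Sum.inl a)) ^ 2
        + 2 * (2 * ((m : ℝ) + n - 2) - 1) * (∑ a, x (Sum.inl a)) * (∑ b, x (Sum.inr b))
        + (2 * m - 1) * (∑ b, x (Sum.inr b)) ^ 2)
      + 2 * ((hyperedgeII m n ⬝ᵥ x) ^ 2 - ∑ i, x i * (hyperedgeII m n i * x i)) := by
    rw [seidelII_eq, seidelS_eq]
    simp only [add_mulVec, sub_mulVec, smul_mulVec, vecMulVec_mulVec, dotProduct_add,
      dotProduct_sub, dotProduct_smul, op_smul_eq_smul, smul_eq_mul,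
      dotProduct_comm x (hyperedgeII m n)]
    simp only [dotProduct, mulVec_diagonal, Fintype.sum_sum_type, Sum.elim_inl, Sum.elim_inr,
      one_mul, zero_mul, Finset.sum_const_zero, ← Finset.sum_mul, ← Finset.mul_sum,
      mul_left_comm (x _), ← sq]
    ring
  simp only [dotProduct, Fintype.sum_sum_type, Sum.elim_inl, Sum.elim_inr, ← Finset.mul_sum] at hx
  set X := ∑ a, x (Sum.inl a)
  set Y := ∑ b, x (Sum.inr b)
  have hneg : (2 * (n : ℝ) - 1) * X ^ 2 + 2 * (2 * ((m : ℝ) + n - 2) - 1) * X * Y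
      + (2 * m - 1) * Y ^ 2 ≤ 0 := by
    have hq : (2 * (n : ℝ) - 1) * (2 * m - 1) ≤ (2 * ((m : ℝ) + n - 2) - 1) ^ 2 := by nlinarith
    have h : (2 * (n : ℝ) - 1) * ((2 * (n : ℝ) - 1) * X ^ 2
        + 2 * (2 * ((m : ℝ) + n - 2) - 1) * X * Y + (2 * m - 1) * Y ^ 2) ≤ 0 := by
      have h1 := mul_le_mul_of_nonneg_right hq (sq_nonneg Y)
      have h2 := congrArg (fun t => t * t) hx
      simp only [mul_zero] at h2
      linarith
    exact nonpos_of_mul_nonpos_right h (by linarith)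
  rw [hform]
  nlinarith [sq_nonneg (hyperedgeII m n ⬝ᵥ x)]

theorem stmt14 (m n : ℕ) (hm : 3 ≤ m) (hn : 3 ≤ n) :
    seidelEnergy (seidelII m n) < seidelEnergy (seidelS m n) := by
  have hm' : (3 : ℝ) ≤ m := by exact_mod_cast hm
  have hn' : (3 : ℝ) ≤ n := by exact_mod_cast hn
  have : Nonempty (Fin m ⊕ Fin n) := ⟨Sum.inl ⟨0, by omega⟩⟩
  refine seidelEnergy_lt_of_le (isHermitian_seidelS m n) (isHermitian_seidelII m n)
    (p := Sum.inl ⟨0, by omega⟩) (q := Sum.inl ⟨1, by omega⟩) ?_ ?_ ?_ ?_ ?_ ?_ _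
    (fun x => seidelII_form_nonneg hm hn x)
  · intro i
    simp [seidelS]
  · rintro (i | i) <;> simp [seidelII, seidelS]
    omega
  · rintro (i | i) (j | j) hij <;> simp [seidelS] <;> grind
  · rintro (i | i) (j | j) <;> simp only [seidelII, seidelS] <;> split_ifs <;> linarith
  · rintro (i | i) (j | j) <;> simp only [seidelII, seidelS] <;> split_ifs <;>
      first | linarith | (simp_all <;> omega)
  · simp [seidelII, seidelS]
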